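/- Assume λ_N^W > 0, let 0 < α ≤ min{λ_N^W/L, 1/(L+μ)} and β = (1−√(αμ))/(1+√(αμ)), and assume ‖x^∞ − x^*‖ ≤ √N C₁ α/(1−γ). Then for every k ≥ 0 the D-ASG iterates satisfy E[‖x^{(k)} − x^*‖²] ≤ 4(1−√(αμ))^k V_{S,α}(ξ₀)/μ + (2σ²N√α/(μ√μ))·(2 − λ_N^W + αL) + 2C₁²Nα²/(1−γ)². -/

import Mathlib

open MeasureTheory Filter Real ProbabilityTheory
open scoped RealInnerProductSpace ENNReal NNReal Matrix

/-- The penalized objective `F_{W,α}(x) = (1/(2α)) xᵀ(I−𝒲)x + F(x)`. -/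
noncomputable def penObj {N d : ℕ} (W : Matrix (Fin N) (Fin N) ℝ) (α : ℝ)
    (f : Fin N → EuclideanSpace ℝ (Fin d) → ℝ)
    (x : PiLp 2 (fun _ : Fin N => EuclideanSpace ℝ (Fin d))) : ℝ :=
  1 / (2 * α) * ((∑ i, ‖x i‖ ^ 2) - ∑ i, ∑ j, W i j * ⟪x i, x j⟫) + ∑ i, f i (x i)

/-- The Lyapunov function `V_{S,α}(ξ) = ξᵀS_αξ + F_{W,α}(Tξ+x^∞) − F_{W,α}(x^∞)` with
`S_α = (vvᵀ) ⊗ I_{Nd}`, `v = (√(1/(2α)), √(μ/2) − √(1/(2α)))ᵀ`, written for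
`ξ = (a, b) ∈ ℝ^{Nd} × ℝ^{Nd}` (so that `ξᵀS_αξ = ‖v₁a + v₂b‖²`). -/
noncomputable def lyapS {N d : ℕ} (W : Matrix (Fin N) (Fin N) ℝ) (α μ : ℝ)
    (f : Fin N → EuclideanSpace ℝ (Fin d) → ℝ)
    (xinf a b : PiLp 2 (fun _ : Fin N => EuclideanSpace ℝ (Fin d))) : ℝ :=
  ‖Real.sqrt (1 / (2 * α)) • a + (Real.sqrt (μ / 2) - Real.sqrt (1 / (2 * α))) • b‖ ^ 2 +
    penObj W α f (a + xinf) - penObj W α f xinf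

section GradientInequalities

variable {E : Type*} [NormedAddCommGroup E] [InnerProductSpace ℝ E] [CompleteSpace E]

theorem HasGradientAt.hasDerivAt_comp_segment {f : E → ℝ} {g y z : E} {t : ℝ}
    (hf : HasGradientAt f g (y + t • (z - y))) :
    HasDerivAt (fun t : ℝ => f (y + t • (z - y))) ⟪g, z - y⟫ t := by
  have hline : HasDerivAt (fun t : ℝ => y + t • (z - y)) (z - y) t := by
    simpa using ((hasDerivAt_id t).smul_const (z - y)).const_add y
  exact (hasGradientAt_iff_hasFDerivAt.mp hf).comp_hasDerivAt t hline

theorem ConvexOn.add_inner_add_sq_le {f : E → ℝ} {μ : ℝ} {g y : E}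
    (hf : ConvexOn ℝ Set.univ fun x => f x - μ / 2 * ‖x‖ ^ 2) (hg : HasGradientAt f g y) (z : E) :
    f y + ⟪g, z - y⟫ + μ / 2 * ‖z - y‖ ^ 2 ≤ f z := by
  have hconv : ConvexOn ℝ Set.univ
      (fun t : ℝ => f (y + t • (z - y)) - μ / 2 * ‖y + t • (z - y)‖ ^ 2) := by
    have := hf.comp_affineMap (AffineMap.lineMap y z : ℝ →ᵃ[ℝ] E)
    simpa [Function.comp_def, AffineMap.lineMap_apply, add_comm] using this
  have hline : HasDerivAt (fun t : ℝ => y + t • (z - y)) (z - y) 0 := by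
    simpa using ((hasDerivAt_id (0 : ℝ)).smul_const (z - y)).const_add y
  have hderiv : HasDerivAt
      (fun t : ℝ => f (y + t • (z - y)) - μ / 2 * ‖y + t • (z - y)‖ ^ 2)
      (⟪g, z - y⟫ - μ / 2 * (2 * ⟪y, z - y⟫)) 0 := by
    have h1 : HasDerivAt (fun t : ℝ => f (y + t • (z - y))) ⟪g, z - y⟫ 0 :=
      HasGradientAt.hasDerivAt_comp_segment (by simpa using hg)
    simpa using h1.fun_sub (hline.norm_sq.const_mul (μ / 2))
  have hslope := hconv.le_slope_of_hasDerivAt (Set.mem_univ 0) (Set.mem_univ 1) one_pos hderiv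
  simp only [slope_def_field, zero_smul, add_zero, one_smul, add_sub_cancel, sub_zero,
    div_one] at hslope
  have hz : ‖z‖ ^ 2 = ‖y‖ ^ 2 + 2 * ⟪y, z - y⟫ + ‖z - y‖ ^ 2 := by
    rw [← norm_add_sq_real, add_sub_cancel]
  rw [hz] at hslope
  linarith

theorem LipschitzWith.le_add_inner_add_sq {f : E → ℝ} {g : E → E} {L : ℝ≥0}
    (hL : LipschitzWith L g) (hg : ∀ x, HasGradientAt f (g x) x) (y z : E) :
    f z ≤ f y + ⟪g y, z - y⟫ + L / 2 * ‖z - y‖ ^ 2 := by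
  let ψ : ℝ → ℝ := fun t =>
    f (y + t • (z - y)) - t * ⟪g y, z - y⟫ - L / 2 * ‖z - y‖ ^ 2 * t ^ 2
  have hderiv (t : ℝ) : HasDerivAt ψ
      (⟪g (y + t • (z - y)), z - y⟫ - ⟪g y, z - y⟫ - L / 2 * ‖z - y‖ ^ 2 * (2 * t)) t := by
    have h1 := (hg (y + t • (z - y))).hasDerivAt_comp_segment
    have h2 := (hasDerivAt_id t).mul_const ⟪g y, z - y⟫
    have h3 := (hasDerivAt_pow 2 t).const_mul (L / 2 * ‖z - y‖ ^ 2)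
    simpa [ψ] using (h1.fun_sub h2).fun_sub h3
  have hanti : AntitoneOn ψ (Set.Icc 0 1) := by
    refine antitoneOn_of_deriv_nonpos (convex_Icc 0 1)
      (fun t _ => (hderiv t).continuousAt.continuousWithinAt)
      (fun t _ => (hderiv t).differentiableAt.differentiableWithinAt) fun t ht => ?_
    rw [interior_Icc] at ht
    rw [(hderiv t).deriv, ← inner_sub_left]
    have h1 : ‖g (y + t • (z - y)) - g y‖ ≤ L * (t * ‖z - y‖) := by
      have := hL.norm_sub_le (y + t • (z - y)) y
      rwa [add_sub_cancel_left, norm_smul, Real.norm_of_nonneg ht.1.le] at this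
    have h2 := real_inner_le_norm (g (y + t • (z - y)) - g y) (z - y)
    nlinarith [mul_le_mul_of_nonneg_right h1 (norm_nonneg (z - y))]
  have := hanti (Set.left_mem_Icc.mpr zero_le_one) (Set.right_mem_Icc.mpr zero_le_one) zero_le_one
  simp only [ψ, one_smul, zero_smul, add_zero, add_sub_cancel] at this
  linarith

end GradientInequalities

section AcceleratedGradient

variable {E : Type*} [NormedAddCommGroup E] [InnerProductSpace ℝ E]

/-- One step of Nesterov's accelerated gradient method decreases the Lyapunov function, up to
terms linear and quadratic in the gradient error `w`. -/
theorem accelerated_gradient_lyapunov_step {G : E → ℝ} {g : E → E} {μ M α s : ℝ}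
    (hlow : ∀ y z, G y + ⟪g y, z - y⟫ + μ / 2 * ‖z - y‖ ^ 2 ≤ G z)
    (hup : ∀ y z, G z ≤ G y + ⟪g y, z - y⟫ + M / 2 * ‖z - y‖ ^ 2)
    (hμ : 0 < μ) (hα : 0 < α) (hαM : α * M ≤ 1) (hs0 : 0 ≤ s) (hs1 : s ≤ 1) (hs : s ^ 2 = α * μ)
    (p : E) {x x' y x₁ w : E} (hy : (1 + s) • y = (2 : ℝ) • x - (1 - s) • x')
    (hx₁ : x₁ = y - α • (g y + w)) :
    1 / (2 * α) * ‖(x₁ - p) - (1 - s) • (x - p)‖ ^ 2 + (G x₁ - G p) ≤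
      (1 - s) * (1 / (2 * α) * ‖(x - p) - (1 - s) • (x' - p)‖ ^ 2 + (G x - G p)) +
      ⟪(M * α ^ 2) • g y - (1 - s) • ((x - p) - (1 - s) • (x' - p)) - s ^ 2 • (y - p), w⟫ +
      α / 2 * (1 + α * M) * ‖w‖ ^ 2 := by
  set u : E := (x - p) - (1 - s) • (x' - p) with hu
  set Y : E := y - p with hY
  set q : E := g y with hq
  have hX : x - p = (1 + s) • Y - u := by
    have : (1 - s) • x' = (2 : ℝ) • x - (1 + s) • y := by rw [hy]; abel
    rw [hu, hY, smul_sub (1 - s), this]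
    module
  have hu₁ : (x₁ - p) - (1 - s) • (x - p) = ((1 - s) • u + s ^ 2 • Y) - α • (q + w) := by
    rw [hX, hx₁]
    have : y = Y + p := by rw [hY]; abel
    rw [this]
    module
  have h1 := hlow y x
  have h2 := hlow y p
  have h3 := hup y x₁
  rw [show x - y = s • Y - u by
    rw [← sub_sub_sub_cancel_right x y p, hX, ← hY]; module] at h1
  rw [show p - y = -Y by rw [hY]; abel] at h2
  rw [show x₁ - y = -(α • (q + w)) by rw [hx₁]; abel] at h3
  rw [← hq] at h1 h2 h3
  have hsplit : 1 / (2 * α) * ‖(1 - s) • u + s ^ 2 • Y‖ ^ 2 ≤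
      (1 - s) * (1 / (2 * α) * ‖u‖ ^ 2) + s * (μ / 2 * ‖Y‖ ^ 2) := by
    have hnn : 0 ≤ 1 / (2 * α) * (s * (1 - s) * ‖u - s • Y‖ ^ 2) := by
      have := sub_nonneg.mpr hs1
      positivity
    have hμ' : μ / 2 * ‖Y‖ ^ 2 = 1 / (2 * α) * (s ^ 2 * ‖Y‖ ^ 2) := by
      rw [hs]; field_simp
    rw [hμ']
    refine le_of_sub_nonneg (hnn.trans_eq ?_)
    simp only [norm_sub_sq_real, norm_add_sq_real, norm_smul, inner_smul_left, inner_smul_right,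
      mul_pow, Real.norm_eq_abs, sq_abs, conj_trivial]
    ring
  have hexp : 1 / (2 * α) * ‖((1 - s) • u + s ^ 2 • Y) - α • (q + w)‖ ^ 2 =
      1 / (2 * α) * ‖(1 - s) • u + s ^ 2 • Y‖ ^ 2 - ((1 - s) * (⟪q, u⟫ + ⟪u, w⟫) +
        s ^ 2 * (⟪q, Y⟫ + ⟪Y, w⟫)) + α / 2 * (‖q‖ ^ 2 + 2 * ⟪q, w⟫ + ‖w‖ ^ 2) := by
    rw [norm_sub_sq_real, norm_smul, mul_pow, norm_add_sq_real q w, Real.norm_eq_abs, sq_abs]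
    simp only [inner_smul_left, inner_smul_right, inner_add_left, inner_add_right, conj_trivial]
    rw [real_inner_comm q u, real_inner_comm q Y]
    field_simp
    ring
  rw [hu₁, hexp]
  generalize ‖(1 - s) • u + s ^ 2 • Y‖ ^ 2 = c at hsplit
  simp only [norm_neg, inner_neg_right, inner_smul_right, inner_add_right, inner_sub_right,
    inner_sub_left, inner_smul_left, real_inner_self_eq_norm_sq, conj_trivial,
    norm_smul, mul_pow, Real.norm_eq_abs, sq_abs, norm_add_sq_real] at h1 h2 h3 ⊢
  have h1' := mul_le_mul_of_nonneg_left h1 (sub_nonneg.mpr hs1)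
  have h2' := mul_le_mul_of_nonneg_left h2 hs0
  have h4 : 0 ≤ (1 - s) * (μ / 2 * ‖s • Y - u‖ ^ 2) := by
    have := sub_nonneg.mpr hs1
    positivity
  have h5 : 0 ≤ α / 2 * ((1 - α * M) * ‖q‖ ^ 2) := by
    have := sub_nonneg.mpr hαM
    positivity
  nlinarith [h1', h2', h3, h4, h5, hsplit]

end AcceleratedGradient

section InnerIntegrability

variable {E Ω : Type*} [NormedAddCommGroup E] [InnerProductSpace ℝ E]
  {mΩ : MeasurableSpace Ω} {P : Measure Ω}

theorem MeasureTheory.MemLp.integrable_real_inner {a b : Ω → E}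
    (ha : MemLp a 2 P) (hb : MemLp b 2 P) : Integrable (fun ω => ⟪a ω, b ω⟫) P := by
  refine (ha.norm.integrable_sq.add hb.norm.integrable_sq).mono'
    (ha.aestronglyMeasurable.inner hb.aestronglyMeasurable) (ae_of_all _ fun ω => ?_)
  have := abs_real_inner_le_norm (a ω) (b ω)
  simp only [Pi.add_apply, Real.norm_eq_abs]
  nlinarith [sq_nonneg (‖a ω‖ - ‖b ω‖), sq_nonneg (‖a ω‖ + ‖b ω‖)]

theorem integral_real_inner_eq_zero_of_condExp_eq_zero [CompleteSpace E] [IsFiniteMeasure P]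
    {m : MeasurableSpace Ω} (hm : m ≤ mΩ) {a b : Ω → E} (ham : StronglyMeasurable[m] a)
    (ha : MemLp a 2 P) (hb : MemLp b 2 P) (hb0 : P[b|m] =ᵐ[P] 0) :
    ∫ ω, ⟪a ω, b ω⟫ ∂P = 0 := by
  have hpull := condExp_bilin_of_stronglyMeasurable_left (innerSL ℝ) ham
    (ha.integrable_real_inner hb) (hb.integrable one_le_two)
  calc ∫ ω, ⟪a ω, b ω⟫ ∂P = ∫ ω, (P[fun ω => ⟪a ω, b ω⟫|m]) ω ∂P := (integral_condExp hm).symm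
    _ = ∫ _, (0 : ℝ) ∂P := by
      refine integral_congr_ae ?_
      filter_upwards [hpull, hb0] with ω h1 h2
      refine h1.trans ?_
      simp [h2]
    _ = 0 := integral_zero _ _

end InnerIntegrability

section StochasticAcceleratedGradient

variable {E Ω : Type*} [NormedAddCommGroup E] [InnerProductSpace ℝ E] [CompleteSpace E]
  {mΩ : MeasurableSpace Ω} {P : Measure Ω} [IsProbabilityMeasure P]

/-- Nesterov's accelerated method with stochastic gradients: mean-square distance to the
stationary point `p` of a strongly convex smooth function `G` with gradient `g`. -/
theorem integral_sq_norm_stochastic_accelerated_gradient_le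
    {G : E → ℝ} {g : E → E} {μ M α s B : ℝ}
    (hlow : ∀ y z, G y + ⟪g y, z - y⟫ + μ / 2 * ‖z - y‖ ^ 2 ≤ G z)
    (hup : ∀ y z, G z ≤ G y + ⟪g y, z - y⟫ + M / 2 * ‖z - y‖ ^ 2)
    (hG : Continuous G) (hg : Continuous g)
    (hμ : 0 < μ) (hM : 0 ≤ M) (hα : 0 < α) (hαM : α * M ≤ 1)
    (hs0 : 0 < s) (hs1 : s ≤ 1) (hs : s ^ 2 = α * μ)
    {p : E} (hp : g p = 0)
    {ℱ : ℕ → MeasurableSpace Ω} (hℱ : ∀ k, ℱ k ≤ mΩ) (hℱmono : Monotone ℱ)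
    {X X' Y w : ℕ → Ω → E} {x₀ x₀' : E}
    (hX0 : ∀ ω, X 0 ω = x₀) (hX'0 : ∀ ω, X' 0 ω = x₀') (hX'S : ∀ k ω, X' (k + 1) ω = X k ω)
    (hY : ∀ k ω, (1 + s) • Y k ω = (2 : ℝ) • X k ω - (1 - s) • X' k ω)
    (hX : ∀ k, StronglyMeasurable[ℱ k] (X k))
    (hw : ∀ k, StronglyMeasurable[ℱ (k + 1)] (w (k + 1)))
    (hrec : ∀ k ω, X (k + 1) ω = Y k ω - α • (g (Y k ω) + w (k + 1) ω))
    (hwmean : ∀ k, P[w (k + 1)|ℱ k] =ᵐ[P] 0)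
    (hwL2 : ∀ k, Integrable (fun ω => ‖w (k + 1) ω‖ ^ 2) P)
    (hwvar : ∀ k, ∀ᵐ ω ∂P, (P[fun ω' => ‖w (k + 1) ω'‖ ^ 2|ℱ k]) ω ≤ B) (k : ℕ) :
    Integrable (fun ω => ‖X k ω - p‖ ^ 2) P ∧
      μ / 2 * ∫ ω, ‖X k ω - p‖ ^ 2 ∂P ≤
        (1 - s) ^ k * (1 / (2 * α) * ‖(x₀ - p) - (1 - s) • (x₀' - p)‖ ^ 2 + (G x₀ - G p)) +
          α / (2 * s) * (1 + α * M) * B := by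
  have hgap (z : E) : μ / 2 * ‖z - p‖ ^ 2 ≤ G z - G p := by
    have := hlow p z
    rw [hp, inner_zero_left] at this
    linarith
  have hgap' (z : E) : G z - G p ≤ M / 2 * ‖z - p‖ ^ 2 := by
    have := hup p z
    rw [hp, inner_zero_left] at this
    linarith
  have hgnorm (z : E) : ‖g z‖ ≤ Real.sqrt (M / α) * ‖z - p‖ := by
    have h1 := hup z (z - α • g z)
    rw [sub_sub_cancel_left, norm_neg, inner_neg_right, inner_smul_right,
      real_inner_self_eq_norm_sq, norm_smul, mul_pow, Real.norm_of_nonneg hα.le] at h1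
    have h2 := hgap (z - α • g z)
    have h3 := hgap' z
    have h4 : 0 ≤ α / 2 * ((1 - α * M) * ‖g z‖ ^ 2) := by
      have := sub_nonneg.mpr hαM
      positivity
    have h5 : 0 ≤ μ / 2 * ‖z - α • g z - p‖ ^ 2 := by positivity
    have h6 : α * ‖g z‖ ^ 2 ≤ M * ‖z - p‖ ^ 2 := by nlinarith
    refine abs_le_of_sq_le_sq' ?_ (by positivity) |>.2
    rw [mul_pow, Real.sq_sqrt (by positivity), div_mul_eq_mul_div, le_div_iff₀ hα]
    linarith
  have hs' : (1 + s) ≠ 0 := by positivity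
  have hYeq (k : ℕ) : Y k = fun ω => (1 + s)⁻¹ • ((2 : ℝ) • X k ω - (1 - s) • X' k ω) := by
    funext ω
    rw [← hY, inv_smul_smul₀ hs']
  have hX'm (k : ℕ) : StronglyMeasurable[ℱ k] (X' k) := by
    cases k with
    | zero => simpa only [funext hX'0] using stronglyMeasurable_const
    | succ k => simpa only [funext (hX'S k)] using (hX k).mono (hℱmono k.le_succ)
  have hYm (k : ℕ) : StronglyMeasurable[ℱ k] (Y k) := by
    rw [hYeq]
    exact (((hX k).const_smul _).sub ((hX'm k).const_smul _)).const_smul _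
  have hwLp (k : ℕ) : MemLp (w (k + 1)) 2 P :=
    (memLp_two_iff_integrable_sq_norm ((hw k).mono (hℱ _)).aestronglyMeasurable).mpr (hwL2 k)
  have hYLp {k : ℕ} (h : MemLp (X k) 2 P) (h' : MemLp (X' k) 2 P) : MemLp (Y k) 2 P := by
    rw [hYeq]
    exact ((h.const_smul _).sub (h'.const_smul _)).const_smul _
  have hgYm (k : ℕ) : StronglyMeasurable[ℱ k] fun ω => g (Y k ω) :=
    hg.comp_stronglyMeasurable (hYm k)
  have hgYLp {k : ℕ} (h : MemLp (Y k) 2 P) : MemLp (fun ω => g (Y k ω)) 2 P :=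
    (h.sub (memLp_const p)).of_le_mul ((hgYm k).mono (hℱ k)).aestronglyMeasurable
      (ae_of_all _ fun ω => hgnorm (Y k ω))
  have hLp (k : ℕ) : MemLp (X k) 2 P ∧ MemLp (X' k) 2 P := by
    induction k with
    | zero =>
      rw [funext hX0, funext hX'0]
      exact ⟨memLp_const _, memLp_const _⟩
    | succ k ih =>
      have hYk := hYLp ih.1 ih.2
      rw [funext (hrec k), funext (hX'S k)]
      exact ⟨hYk.sub (((hgYLp hYk).add (hwLp k)).const_smul α), ih.1⟩
  let V : ℕ → Ω → ℝ := fun k ω =>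
    1 / (2 * α) * ‖(X k ω - p) - (1 - s) • (X' k ω - p)‖ ^ 2 + (G (X k ω) - G p)
  have hdist (k : ℕ) : Integrable (fun ω => ‖X k ω - p‖ ^ 2) P :=
    ((hLp k).1.sub (memLp_const p)).norm.integrable_sq
  have hVint (k : ℕ) : Integrable (V k) P := by
    refine Integrable.add ?_ ?_
    · exact (((hLp k).1.sub (memLp_const p)).sub
        (((hLp k).2.sub (memLp_const p)).const_smul (1 - s))).norm.integrable_sq.const_mul _
    · refine ((hdist k).const_mul (M / 2)).mono'
        ((hG.comp_stronglyMeasurable ((hX k).mono (hℱ k))).aestronglyMeasurable.sub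
          aestronglyMeasurable_const) (ae_of_all _ fun ω => ?_)
      rw [Real.norm_of_nonneg (le_trans (by positivity) (hgap (X k ω)))]
      exact hgap' _
  have hB (k : ℕ) : ∫ ω, ‖w (k + 1) ω‖ ^ 2 ∂P ≤ B := by
    rw [← integral_condExp (hℱ k)]
    calc _ ≤ ∫ _, B ∂P := integral_mono_ae integrable_condExp (integrable_const B) (hwvar k)
      _ = B := by simp
  let c : ℝ := α / 2 * (1 + α * M)
  have hc : 0 ≤ c := by positivity
  have hstep (k : ℕ) : ∫ ω, V (k + 1) ω ∂P ≤ (1 - s) * ∫ ω, V k ω ∂P + c * B := by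
    let Z : Ω → E := fun ω => (M * α ^ 2) • g (Y k ω) -
      (1 - s) • ((X k ω - p) - (1 - s) • (X' k ω - p)) - s ^ 2 • (Y k ω - p)
    have hYk := hYLp (hLp k).1 (hLp k).2
    have hZLp : MemLp Z 2 P :=
      (((hgYLp hYk).const_smul _).sub ((((hLp k).1.sub (memLp_const p)).sub
        (((hLp k).2.sub (memLp_const p)).const_smul _)).const_smul _)).sub
        ((hYk.sub (memLp_const p)).const_smul _)
    have hZm : StronglyMeasurable[ℱ k] Z :=
      (((hgYm k).const_smul _).sub ((((hX k).sub stronglyMeasurable_const).sub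
        (((hX'm k).sub stronglyMeasurable_const).const_smul _)).const_smul _)).sub
        (((hYm k).sub stronglyMeasurable_const).const_smul _)
    have hZ0 := integral_real_inner_eq_zero_of_condExp_eq_zero (hℱ k) hZm hZLp (hwLp k) (hwmean k)
    have hZint := hZLp.integrable_real_inner (hwLp k)
    have hVs := (hVint k).const_mul (1 - s)
    calc ∫ ω, V (k + 1) ω ∂P
        ≤ ∫ ω, ((1 - s) * V k ω + ⟪Z ω, w (k + 1) ω⟫ + c * ‖w (k + 1) ω‖ ^ 2) ∂P := by
          refine integral_mono (hVint _) ((hVs.add hZint).add ((hwL2 k).const_mul c)) fun ω => ?_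
          simp only [V, hX'S]
          exact accelerated_gradient_lyapunov_step hlow hup hμ hα hαM hs0.le hs1 hs p (hY k ω)
            (hrec k ω)
      _ = (1 - s) * ∫ ω, V k ω ∂P + c * ∫ ω, ‖w (k + 1) ω‖ ^ 2 ∂P := by
          rw [integral_add (by exact hVs.add hZint) ((hwL2 k).const_mul c), integral_add hVs hZint, hZ0,
            integral_const_mul, integral_const_mul, add_zero]
      _ ≤ _ := by gcongr; exact hB k
  have hB0 : 0 ≤ B := (integral_nonneg fun ω => sq_nonneg ‖w (0 + 1) ω‖).trans (hB 0)
  have hV (k : ℕ) : ∫ ω, V k ω ∂P ≤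
      (1 - s) ^ k * (1 / (2 * α) * ‖(x₀ - p) - (1 - s) • (x₀' - p)‖ ^ 2 + (G x₀ - G p)) +
        c * B / s := by
    induction k with
    | zero =>
      simp only [V, hX0, hX'0, integral_const, probReal_univ, one_smul, pow_zero, one_mul]
      exact le_add_of_nonneg_right (by positivity)
    | succ k ih =>
      refine (hstep k).trans ?_
      have h1 := mul_le_mul_of_nonneg_left ih (sub_nonneg.mpr hs1)
      have h2 : c * B / s * s = c * B := div_mul_cancel₀ _ hs0.ne'
      rw [pow_succ]
      nlinarith
  refine ⟨hdist k, ?_⟩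
  rw [← integral_const_mul]
  refine (integral_mono ((hdist k).const_mul _) (hVint k) fun ω => ?_).trans
    ((hV k).trans_eq ?_)
  · exact (hgap (X k ω)).trans (le_add_of_nonneg_left (by positivity))
  · simp only [c]
    field_simp

end StochasticAcceleratedGradient

section PenalizedObjective

variable {N d : ℕ}

/-- The mixing operator `𝒲 = W ⊗ I_d`. -/
noncomputable def mixing (W : Matrix (Fin N) (Fin N) ℝ)
    (x : PiLp 2 (fun _ : Fin N => EuclideanSpace ℝ (Fin d))) :
    PiLp 2 (fun _ : Fin N => EuclideanSpace ℝ (Fin d)) :=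
  WithLp.toLp 2 fun i => ∑ j, W i j • x j

/-- The gradient of the penalized objective `penObj`. -/
noncomputable def penGrad (W : Matrix (Fin N) (Fin N) ℝ) (α : ℝ)
    (gradf : Fin N → EuclideanSpace ℝ (Fin d) → EuclideanSpace ℝ (Fin d))
    (x : PiLp 2 (fun _ : Fin N => EuclideanSpace ℝ (Fin d))) :
    PiLp 2 (fun _ : Fin N => EuclideanSpace ℝ (Fin d)) :=
  (1 / α) • (x - mixing W x) + WithLp.toLp 2 fun i => gradf i (x i)

theorem penGrad_apply (W : Matrix (Fin N) (Fin N) ℝ) (α : ℝ)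
    (gradf : Fin N → EuclideanSpace ℝ (Fin d) → EuclideanSpace ℝ (Fin d))
    (x : PiLp 2 (fun _ : Fin N => EuclideanSpace ℝ (Fin d))) (i : Fin N) :
    penGrad W α gradf x i = (1 / α) • (x i - ∑ j, W i j • x j) + gradf i (x i) := rfl

theorem mixing_sub (W : Matrix (Fin N) (Fin N) ℝ)
    (x y : PiLp 2 (fun _ : Fin N => EuclideanSpace ℝ (Fin d))) :
    mixing W (x - y) = mixing W x - mixing W y := by
  refine PiLp.ext fun i => ?_
  simp [mixing, smul_sub]

theorem inner_mixing (W : Matrix (Fin N) (Fin N) ℝ)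
    (x y : PiLp 2 (fun _ : Fin N => EuclideanSpace ℝ (Fin d))) :
    ⟪x, mixing W y⟫ = ∑ i, ∑ j, W i j * ⟪x i, y j⟫ := by
  rw [PiLp.inner_apply]
  refine Finset.sum_congr rfl fun i _ => ?_
  change ⟪x i, ∑ j, W i j • y j⟫ = _
  rw [inner_sum]
  exact Finset.sum_congr rfl fun j _ => inner_smul_right _ _ _

theorem inner_mixing_comm {W : Matrix (Fin N) (Fin N) ℝ} (hW : W.IsSymm)
    (x y : PiLp 2 (fun _ : Fin N => EuclideanSpace ℝ (Fin d))) :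
    ⟪x, mixing W y⟫ = ⟪y, mixing W x⟫ := by
  rw [inner_mixing, inner_mixing, Finset.sum_comm]
  refine Finset.sum_congr rfl fun i _ => Finset.sum_congr rfl fun j _ => ?_
  rw [hW.apply, real_inner_comm]

theorem inner_mixing_self_of_diagonalization (V : Matrix (Fin N) (Fin N) ℝ) (lam : Fin N → ℝ)
    (x : PiLp 2 (fun _ : Fin N => EuclideanSpace ℝ (Fin d))) :
    ⟪x, mixing (Vᵀ * Matrix.diagonal lam * V) x⟫ = ∑ k, lam k * ‖mixing V x k‖ ^ 2 := by
  have hentry (i j : Fin N) :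
      (Vᵀ * Matrix.diagonal lam * V) i j = ∑ k, lam k * (V k i * V k j) := by
    rw [Matrix.mul_apply]
    refine Finset.sum_congr rfl fun k _ => ?_
    rw [Matrix.mul_diagonal, Matrix.transpose_apply]
    ring
  have hnorm (k : Fin N) : ‖mixing V x k‖ ^ 2 = ∑ i, ∑ j, V k i * V k j * ⟪x i, x j⟫ := by
    change ‖∑ j, V k j • x j‖ ^ 2 = _
    rw [← real_inner_self_eq_norm_sq, sum_inner]
    refine Finset.sum_congr rfl fun i _ => ?_
    rw [inner_sum]
    refine Finset.sum_congr rfl fun j _ => ?_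
    rw [real_inner_smul_left, real_inner_smul_right, mul_assoc]
  simp_rw [inner_mixing, hentry, hnorm, Finset.mul_sum, Finset.sum_mul]
  rw [Finset.sum_congr rfl fun i _ => Finset.sum_comm, Finset.sum_comm]
  simp only [mul_assoc]

theorem norm_sq_eq_sum_mixing {V : Matrix (Fin N) (Fin N) ℝ} (hV : Vᵀ * V = 1)
    (x : PiLp 2 (fun _ : Fin N => EuclideanSpace ℝ (Fin d))) :
    ‖x‖ ^ 2 = ∑ k, ‖mixing V x k‖ ^ 2 := by
  have h := inner_mixing_self_of_diagonalization V (fun _ => 1) x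
  rw [Matrix.diagonal_one, mul_one, hV, inner_mixing] at h
  simpa [Matrix.one_apply, PiLp.norm_sq_eq_of_L2] using h

theorem inner_mixing_le {V W : Matrix (Fin N) (Fin N) ℝ} {lam : Fin N → ℝ} {c : ℝ}
    (hV : Vᵀ * V = 1) (hW : W = Vᵀ * Matrix.diagonal lam * V) (hc : ∀ k, lam k ≤ c)
    (x : PiLp 2 (fun _ : Fin N => EuclideanSpace ℝ (Fin d))) :
    ⟪x, mixing W x⟫ ≤ c * ‖x‖ ^ 2 := by
  rw [hW, inner_mixing_self_of_diagonalization, norm_sq_eq_sum_mixing hV, Finset.mul_sum]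
  exact Finset.sum_le_sum fun k _ => mul_le_mul_of_nonneg_right (hc k) (sq_nonneg _)

theorem le_inner_mixing {V W : Matrix (Fin N) (Fin N) ℝ} {lam : Fin N → ℝ} {c : ℝ}
    (hV : Vᵀ * V = 1) (hW : W = Vᵀ * Matrix.diagonal lam * V) (hc : ∀ k, c ≤ lam k)
    (x : PiLp 2 (fun _ : Fin N => EuclideanSpace ℝ (Fin d))) :
    c * ‖x‖ ^ 2 ≤ ⟪x, mixing W x⟫ := by
  rw [hW, inner_mixing_self_of_diagonalization, norm_sq_eq_sum_mixing hV, Finset.mul_sum]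
  exact Finset.sum_le_sum fun k _ => mul_le_mul_of_nonneg_right (hc k) (sq_nonneg _)

theorem penObj_eq_inner (W : Matrix (Fin N) (Fin N) ℝ) (α : ℝ)
    (f : Fin N → EuclideanSpace ℝ (Fin d) → ℝ)
    (x : PiLp 2 (fun _ : Fin N => EuclideanSpace ℝ (Fin d))) :
    penObj W α f x = 1 / (2 * α) * ⟪x, x - mixing W x⟫ + ∑ i, f i (x i) := by
  rw [penObj, inner_sub_right, inner_mixing, real_inner_self_eq_norm_sq, PiLp.norm_sq_eq_of_L2]

theorem penObj_eq_add_inner {W : Matrix (Fin N) (Fin N) ℝ} (hW : W.IsSymm) (α : ℝ)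
    (f : Fin N → EuclideanSpace ℝ (Fin d) → ℝ)
    (gradf : Fin N → EuclideanSpace ℝ (Fin d) → EuclideanSpace ℝ (Fin d))
    (y z : PiLp 2 (fun _ : Fin N => EuclideanSpace ℝ (Fin d))) :
    penObj W α f z = penObj W α f y + ⟪penGrad W α gradf y, z - y⟫ +
      (1 / (2 * α) * ⟪z - y, (z - y) - mixing W (z - y)⟫ +
        ∑ i, (f i (z i) - f i (y i) - ⟪gradf i (y i), z i - y i⟫)) := by
  have hsum : ⟪WithLp.toLp 2 fun i => gradf i (y i), z - y⟫ =
      ∑ i, ⟪gradf i (y i), z i - y i⟫ := PiLp.inner_apply _ _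
  rw [penObj_eq_inner, penObj_eq_inner, penGrad, inner_add_left, hsum, mixing_sub,
    Finset.sum_sub_distrib, Finset.sum_sub_distrib]
  simp only [real_inner_smul_left, inner_sub_left, inner_sub_right]
  rw [real_inner_comm z y, real_inner_comm z (mixing W y), real_inner_comm y (mixing W y),
    inner_mixing_comm hW y z]
  ring

theorem continuous_mixing (W : Matrix (Fin N) (Fin N) ℝ) :
    Continuous (mixing W : PiLp 2 (fun _ : Fin N => EuclideanSpace ℝ (Fin d)) → _) := by
  unfold mixing
  fun_prop

theorem continuous_penGrad (W : Matrix (Fin N) (Fin N) ℝ) (α : ℝ)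
    {gradf : Fin N → EuclideanSpace ℝ (Fin d) → EuclideanSpace ℝ (Fin d)}
    (h : ∀ i, Continuous (gradf i)) : Continuous (penGrad W α gradf) := by
  have := continuous_mixing (d := d) W
  unfold penGrad
  fun_prop

theorem continuous_penObj (W : Matrix (Fin N) (Fin N) ℝ) (α : ℝ)
    {f : Fin N → EuclideanSpace ℝ (Fin d) → ℝ} (h : ∀ i, Continuous (f i)) :
    Continuous (penObj W α f) := by
  unfold penObj
  fun_prop

end PenalizedObjective

/-- **Corollary (D-ASG, distance to the optimizer).**  Assume `λ_N^W > 0`,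
`0 < α ≤ min{λ_N^W/L, 1/(L+μ)}`, `β = (1−√(αμ))/(1+√(αμ))` and
`‖x^∞ − x^*‖ ≤ √N C₁ α/(1−γ)`.  Then for every `k ≥ 0` the D-ASG iterates satisfy
`E[‖x^{(k)} − x^*‖²] ≤ 4(1−√(αμ))^k V_{S,α}(ξ₀)/μ + (2σ²N√α/(μ√μ))(2 − λ_N^W + αL)
  + 2C₁²Nα²/(1−γ)²`. -/
theorem dasg_suboptimality_bound
    {N d : ℕ} (hN : 0 < N) (hd : 0 < d)
    (μ L α β σ : ℝ) (hμ : 0 < μ) (hμL : μ ≤ L) (hσ : 0 ≤ σ)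
    -- the symmetric doubly stochastic mixing matrix and its eigenvalues, in decreasing order
    (W : Matrix (Fin N) (Fin N) ℝ)
    (hWsymm : W.IsSymm)
    (hWnonneg : ∀ i j, 0 ≤ W i j)
    (hWrow : ∀ i, ∑ j, W i j = 1)
    (hWcol : ∀ j, ∑ i, W i j = 1)
    (lam : Fin N → ℝ) (V : Matrix (Fin N) (Fin N) ℝ)
    (hV : V * Vᵀ = 1)
    (hWeig : W = Vᵀ * Matrix.diagonal lam * V)
    (hlamAnti : Antitone lam)
    (hlamTop : lam ⟨0, hN⟩ = 1)
    (lamN : ℝ) (hlamN : lamN = lam ⟨N - 1, Nat.sub_lt hN Nat.one_pos⟩)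
    (hlamNpos : 0 < lamN)
    -- γ = max{|λ₂|, |λ_N|} < 1 and a constant C₁ ≥ 0
    (γ C₁ : ℝ) (hγdef : ∀ h2 : 1 < N, γ = max |lam ⟨1, h2⟩| |lamN|)
    (hγ0 : 0 ≤ γ) (hγ1 : γ < 1) (hC₁ : 0 ≤ C₁)
    -- stepsize and momentum
    (hα0 : 0 < α) (hαle : α ≤ min (lamN / L) (1 / (L + μ)))
    (hβ : β = (1 - Real.sqrt (α * μ)) / (1 + Real.sqrt (α * μ)))
    -- the local objectives: μ-strongly convex with L-Lipschitz gradients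
    (f : Fin N → EuclideanSpace ℝ (Fin d) → ℝ)
    (gradf : Fin N → EuclideanSpace ℝ (Fin d) → EuclideanSpace ℝ (Fin d))
    (hgrad : ∀ i x, HasGradientAt (f i) (gradf i x) x)
    (hlip : ∀ i, LipschitzWith (Real.toNNReal L) (gradf i))
    (hconv : ∀ i, ConvexOn ℝ Set.univ (fun x => f i x - μ / 2 * ‖x‖ ^ 2))
    -- the minimizer x_* of f = (1/N)∑ f_i, and x^* = (x_*,…,x_*)
    (xstar : EuclideanSpace ℝ (Fin d))
    (hxstar : ∀ y, (1 / (N : ℝ)) * ∑ i, f i xstar ≤ (1 / (N : ℝ)) * ∑ i, f i y)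
    (xstarN : PiLp 2 (fun _ : Fin N => EuclideanSpace ℝ (Fin d)))
    (hxstarN : ∀ i, xstarN i = xstar)
    -- the fixed point x^∞ : solution of (I − 𝒲)x + α ∇F(x) = 0, and its distance to x^*
    (xinf : PiLp 2 (fun _ : Fin N => EuclideanSpace ℝ (Fin d)))
    (hxinf : ∀ i, (xinf i - ∑ j, W i j • xinf j) + α • gradf i (xinf i) = 0)
    (hxinfstar : ‖xinf - xstarN‖ ≤ Real.sqrt N * C₁ * α / (1 - γ))
    -- probability space, filtration and the D-ASG iterates
    {Ω : Type} {mΩ : MeasurableSpace Ω} (P : Measure Ω) [IsProbabilityMeasure P]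
    (ℱ : ℕ → MeasurableSpace Ω) (hℱ : ∀ k, ℱ k ≤ mΩ) (hℱmono : Monotone ℱ)
    (X Y w : ℕ → Ω → PiLp 2 (fun _ : Fin N => EuclideanSpace ℝ (Fin d)))
    (x0 xm1 : PiLp 2 (fun _ : Fin N => EuclideanSpace ℝ (Fin d)))
    (hX0 : ∀ ω, X 0 ω = x0)
    (hY0 : ∀ ω i, Y 0 ω i = (1 + β) • x0 i - β • xm1 i)
    (hYS : ∀ k ω i, Y (k + 1) ω i = (1 + β) • X (k + 1) ω i - β • X k ω i)
    (hXadapted : ∀ k, StronglyMeasurable[ℱ k] (X k))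
    (hwmeas : ∀ k, StronglyMeasurable[ℱ (k + 1)] (w (k + 1)))
    (hrec : ∀ k ω i, X (k + 1) ω i =
      (∑ j, W i j • Y k ω j) - α • gradf i (Y k ω i) - α • w (k + 1) ω i)
    -- the gradient noise: conditionally centered with conditional variance ≤ σ²N
    (hwmean : ∀ k, P[w (k + 1)|ℱ k] =ᵐ[P] 0)
    (hwL2 : ∀ k, Integrable (fun ω => ‖w (k + 1) ω‖ ^ 2) P)
    (hwvar : ∀ k, ∀ᵐ ω ∂P, (P[fun ω' => ‖w (k + 1) ω'‖ ^ 2|ℱ k]) ω ≤ σ ^ 2 * N) :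
    ∀ k : ℕ,
      ∫ ω, ‖X k ω - xstarN‖ ^ 2 ∂P ≤
        4 * (1 - Real.sqrt (α * μ)) ^ k *
            (lyapS W α μ f xinf (x0 - xinf) (xm1 - xinf) / μ) +
          2 * σ ^ 2 * N * Real.sqrt α / (μ * Real.sqrt μ) * (2 - lamN + α * L) +
          2 * C₁ ^ 2 * N * α ^ 2 / (1 - γ) ^ 2 := by
  have hL : 0 < L := hμ.trans_le hμL
  have hαlam : α * L ≤ lamN := (le_div_iff₀ hL).mp (hαle.trans (min_le_left _ _))
  have hαμ : α * μ ≤ 1 := by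
    have := (le_div_iff₀ (by positivity)).mp (hαle.trans (min_le_right _ _))
    nlinarith [mul_pos hα0 hL]
  have hlam_le (k : Fin N) : lam k ≤ 1 := hlamTop ▸ hlamAnti (Fin.mk_le_of_le_val (Nat.zero_le _))
  have hlam_ge (k : Fin N) : lamN ≤ lam k := by
    rw [hlamN]
    exact hlamAnti (Fin.le_def.mpr (Nat.le_sub_one_of_lt k.isLt))
  have hlamN1 : lamN ≤ 1 := hlamN ▸ hlam_le _
  set s : ℝ := Real.sqrt (α * μ) with hs
  have hs0 : 0 < s := Real.sqrt_pos.mpr (by positivity)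
  have hs1 : s ≤ 1 := Real.sqrt_le_one.mpr hαμ
  have hs2 : s ^ 2 = α * μ := Real.sq_sqrt (by positivity)
  have hβ1 : (1 + s) * (1 + β) = 2 := by rw [hβ]; field_simp; ring
  have hβ2 : (1 + s) * β = 1 - s := by rw [hβ]; field_simp
  let M : ℝ := (1 - lamN) / α + L
  have hM : 0 ≤ M := by
    have := sub_nonneg.mpr hlamN1
    positivity
  have hαM : α * M = 1 - lamN + α * L := by simp only [M]; field_simp
  let g := penGrad W α gradf
  have hgap (y z : PiLp 2 fun _ : Fin N => EuclideanSpace ℝ (Fin d)) :=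
    penObj_eq_add_inner hWsymm α f gradf y z
  have hV' : Vᵀ * V = 1 := mul_eq_one_comm.mp hV
  have hlow (y z : PiLp 2 fun _ : Fin N => EuclideanSpace ℝ (Fin d)) :
      penObj W α f y + ⟪g y, z - y⟫ + μ / 2 * ‖z - y‖ ^ 2 ≤ penObj W α f z := by
    have hquad : 0 ≤ 1 / (2 * α) * ⟪z - y, (z - y) - mixing W (z - y)⟫ := by
      have := inner_mixing_le hV' hWeig hlam_le (z - y)
      rw [inner_sub_right, real_inner_self_eq_norm_sq]
      have : 0 ≤ ‖z - y‖ ^ 2 - ⟪z - y, mixing W (z - y)⟫ := by linarith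
      positivity
    have hsum : μ / 2 * ‖z - y‖ ^ 2 ≤
        ∑ i, (f i (z i) - f i (y i) - ⟪gradf i (y i), z i - y i⟫) := by
      rw [PiLp.norm_sq_eq_of_L2, Finset.mul_sum]
      refine Finset.sum_le_sum fun i _ => ?_
      have := (hconv i).add_inner_add_sq_le (hgrad i (y i)) (z i)
      rw [PiLp.sub_apply]
      linarith
    rw [hgap y z]
    linarith
  have hup (y z : PiLp 2 fun _ : Fin N => EuclideanSpace ℝ (Fin d)) :
      penObj W α f z ≤ penObj W α f y + ⟪g y, z - y⟫ + M / 2 * ‖z - y‖ ^ 2 := by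
    have hquad : 1 / (2 * α) * ⟪z - y, (z - y) - mixing W (z - y)⟫ ≤
        (1 - lamN) / α / 2 * ‖z - y‖ ^ 2 := by
      have := le_inner_mixing hV' hWeig hlam_ge (z - y)
      rw [inner_sub_right, real_inner_self_eq_norm_sq]
      calc _ ≤ 1 / (2 * α) * ((1 - lamN) * ‖z - y‖ ^ 2) := by gcongr; linarith
        _ = _ := by field_simp
    have hsum : ∑ i, (f i (z i) - f i (y i) - ⟪gradf i (y i), z i - y i⟫) ≤
        L / 2 * ‖z - y‖ ^ 2 := by
      rw [PiLp.norm_sq_eq_of_L2, Finset.mul_sum]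
      refine Finset.sum_le_sum fun i _ => ?_
      have := (hlip i).le_add_inner_add_sq (hgrad i) (y i) (z i)
      rw [Real.coe_toNNReal L hL.le] at this
      rw [PiLp.sub_apply]
      linarith
    rw [hgap y z]
    simp only [M]
    linarith
  have hgcont : Continuous g := continuous_penGrad W α fun i => (hlip i).continuous
  have hGcont : Continuous (penObj W α f) :=
    continuous_penObj W α fun i =>
      continuous_iff_continuousAt.mpr fun x => (hgrad i x).differentiableAt.continuousAt
  have hgp : g xinf = 0 := by
    refine PiLp.ext fun i => ?_
    rw [penGrad_apply, eq_neg_of_add_eq_zero_left (hxinf i), one_div, smul_neg,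
      inv_smul_smul₀ hα0.ne', neg_add_cancel, PiLp.zero_apply]
  let X' : ℕ → Ω → PiLp 2 (fun _ : Fin N => EuclideanSpace ℝ (Fin d))
    | 0, _ => xm1
    | k + 1, ω => X k ω
  have hY (k : ℕ) (ω : Ω) : (1 + s) • Y k ω = (2 : ℝ) • X k ω - (1 - s) • X' k ω := by
    refine PiLp.ext fun i => ?_
    cases k with
    | zero =>
      simp only [X', PiLp.smul_apply, PiLp.sub_apply, hY0, hX0, smul_sub, smul_smul, hβ1, hβ2]
    | succ k =>
      simp only [X', PiLp.smul_apply, PiLp.sub_apply, hYS, smul_sub, smul_smul, hβ1, hβ2]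
  have hstep (k : ℕ) (ω : Ω) : X (k + 1) ω = Y k ω - α • (g (Y k ω) + w (k + 1) ω) := by
    refine PiLp.ext fun i => ?_
    rw [hrec, PiLp.sub_apply, PiLp.smul_apply, PiLp.add_apply, penGrad_apply, smul_add, smul_add,
      smul_smul, mul_one_div_cancel hα0.ne', one_smul]
    abel
  intro k
  obtain ⟨hint, hbound⟩ := integral_sq_norm_stochastic_accelerated_gradient_le hlow hup hGcont
    hgcont hμ hM hα0 (by linarith) hs0 hs1 hs2 hgp hℱ hℱmono hX0 (fun _ => rfl : ∀ ω, X' 0 ω = xm1)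
    (fun _ _ => rfl) hY hXadapted hwmeas hstep hwmean hwL2 hwvar k
  have hlyap : lyapS W α μ f xinf (x0 - xinf) (xm1 - xinf) =
      1 / (2 * α) * ‖(x0 - xinf) - (1 - s) • (xm1 - xinf)‖ ^ 2 +
        (penObj W α f x0 - penObj W α f xinf) := by
    have hsqrt : Real.sqrt (μ / 2) = s * Real.sqrt (1 / (2 * α)) := by
      rw [hs, ← Real.sqrt_mul (by positivity)]
      congr 1
      field_simp
    have hvec : Real.sqrt (1 / (2 * α)) • (x0 - xinf) +
        (Real.sqrt (μ / 2) - Real.sqrt (1 / (2 * α))) • (xm1 - xinf) =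
        Real.sqrt (1 / (2 * α)) • ((x0 - xinf) - (1 - s) • (xm1 - xinf)) := by
      rw [hsqrt]
      module
    rw [lyapS, hvec, norm_smul, mul_pow, Real.norm_eq_abs, sq_abs, Real.sq_sqrt (by positivity),
      sub_add_cancel, add_sub_assoc]
  rw [← hlyap, hαM] at hbound
  have hbias : ‖xinf - xstarN‖ ^ 2 ≤ C₁ ^ 2 * N * α ^ 2 / (1 - γ) ^ 2 := by
    refine (pow_le_pow_left₀ (norm_nonneg _) hxinfstar 2).trans_eq ?_
    rw [div_pow, mul_pow, mul_pow, Real.sq_sqrt (Nat.cast_nonneg N)]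
    ring
  have hratio : α / s = Real.sqrt α / Real.sqrt μ := by
    rw [hs, Real.sqrt_mul hα0.le, ← div_div, Real.div_sqrt]
  have hsplit : ∫ ω, ‖X k ω - xstarN‖ ^ 2 ∂P ≤
      2 * ∫ ω, ‖X k ω - xinf‖ ^ 2 ∂P + 2 * ‖xinf - xstarN‖ ^ 2 := by
    calc ∫ ω, ‖X k ω - xstarN‖ ^ 2 ∂P
        ≤ ∫ ω, (2 * ‖X k ω - xinf‖ ^ 2 + 2 * ‖xinf - xstarN‖ ^ 2) ∂P := by
          refine integral_mono_of_nonneg (ae_of_all _ fun ω => by positivity)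
            ((hint.const_mul 2).add (integrable_const _)) (ae_of_all _ fun ω => ?_)
          have h := norm_add_le (X k ω - xinf) (xinf - xstarN)
          rw [sub_add_sub_cancel] at h
          have h2 := pow_le_pow_left₀ (norm_nonneg _) h 2
          dsimp only
          linarith [add_sq_le (a := ‖X k ω - xinf‖) (b := ‖xinf - xstarN‖)]
      _ = _ := by
          rw [integral_add (hint.const_mul 2) (integrable_const _), integral_const_mul]
          simp
  have hmain : 2 * ∫ ω, ‖X k ω - xinf‖ ^ 2 ∂P ≤
      4 / μ * ((1 - s) ^ k * lyapS W α μ f xinf (x0 - xinf) (xm1 - xinf) +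
        α / (2 * s) * (1 + (1 - lamN + α * L)) * (σ ^ 2 * N)) := by
    calc _ = 4 / μ * (μ / 2 * ∫ ω, ‖X k ω - xinf‖ ^ 2 ∂P) := by field_simp; ring
      _ ≤ _ := by gcongr
  refine hsplit.trans ((add_le_add hmain (mul_le_mul_of_nonneg_left hbias zero_le_two)).trans_eq ?_)
  have hnoise : 2 * σ ^ 2 * N * Real.sqrt α / (μ * Real.sqrt μ) =
      2 * σ ^ 2 * N / μ * (α / s) := by
    rw [hratio]; field_simp
  rw [hnoise]
  field_simp
  ring
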